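/- arXiv:1806.09246 — 2 statements merged into one kernel-verified Lean document; each statement's English description precedes it below -/
import Mathlib

section
/- Let H be an N_r × N_t complex matrix, let F₁ be an N_t × k₁ complex matrix, let F₂ be an N_t × k₂ complex matrix, and let c > 0 be a real number. Define C = I_{N_r} + c · H F₁ F₁* H*. Then C is invertible and det(I_{N_r} + c · H (F₁ F₁* + F₂ F₂*) H*) = det(C) · det(I_{k₂} + c · F₂* H* C⁻¹ H F₂). -/
open Matrix

open scoped ComplexOrder in
lemma isUnit_aux {Nr Nt k₁ : ℕ}
    (H : Matrix (Fin Nr) (Fin Nt) ℂ)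
    (F₁ : Matrix (Fin Nt) (Fin k₁) ℂ)
    (c : ℝ) (hc : 0 < c)
    (C : Matrix (Fin Nr) (Fin Nr) ℂ)
    (hC : C = 1 + (c : ℂ) • (H * F₁ * F₁ᴴ * Hᴴ)) : IsUnit C := by
    have h1 : (H * F₁ * F₁ᴴ * Hᴴ).PosSemidef := by
      have := posSemidef_self_mul_conjTranspose (H * F₁)
      rwa [conjTranspose_mul, ← Matrix.mul_assoc] at this
    have hc' : (0 : ℂ) ≤ (c : ℂ) := by exact_mod_cast hc.le
    have h2 : C.PosDef := by
      rw [hC]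
      exact PosDef.one.add_posSemidef (h1.smul hc')
    exact h2.isUnit

/-- Single-step decomposition of the achievable rate (steps (a)–(b) of eq. (21)):
with `C = I + c · H F₁ F₁* H*`, the matrix `C` is invertible and
`det(I + c·H(F₁F₁* + F₂F₂*)H*) = det C · det(I + c·F₂* H* C⁻¹ H F₂)`. -/
theorem stmt0 {Nr Nt k₁ k₂ : ℕ}
    (H : Matrix (Fin Nr) (Fin Nt) ℂ)
    (F₁ : Matrix (Fin Nt) (Fin k₁) ℂ)
    (F₂ : Matrix (Fin Nt) (Fin k₂) ℂ)
    (c : ℝ) (hc : 0 < c)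
    (C : Matrix (Fin Nr) (Fin Nr) ℂ)
    (hC : C = 1 + (c : ℂ) • (H * F₁ * F₁ᴴ * Hᴴ)) :
    IsUnit C ∧
      (1 + (c : ℂ) • (H * (F₁ * F₁ᴴ + F₂ * F₂ᴴ) * Hᴴ)).det =
        C.det * (1 + (c : ℂ) • (F₂ᴴ * Hᴴ * C⁻¹ * H * F₂)).det := by
  have hU : IsUnit C := isUnit_aux H F₁ c hc C hC
  refine ⟨hU, ?_⟩
  have hd : IsUnit C.det := (Matrix.isUnit_iff_isUnit_det C).1 hU
  have e1 : 1 + (c : ℂ) • (H * (F₁ * F₁ᴴ + F₂ * F₂ᴴ) * Hᴴ)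
      = C * (1 + (C⁻¹ * H * F₂) * ((c : ℂ) • (F₂ᴴ * Hᴴ))) := by
    have e2 : C * ((C⁻¹ * H * F₂) * ((c : ℂ) • (F₂ᴴ * Hᴴ)))
        = (c : ℂ) • (H * F₂ * F₂ᴴ * Hᴴ) := by
      simp only [Matrix.mul_assoc, Matrix.mul_smul]
      rw [Matrix.mul_nonsing_inv_cancel_left _ _ hd]
    rw [Matrix.mul_add C, Matrix.mul_one, e2, hC]
    simp only [Matrix.mul_add, Matrix.add_mul, smul_add, Matrix.mul_assoc, add_assoc]
  rw [e1, det_mul, det_one_add_mul_comm]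
  simp only [Matrix.smul_mul, Matrix.mul_assoc]
end

section
/- Let H be an N_r × N_t complex matrix, let F₁, …, F_m be complex matrices where F_i has size N_t × k_i, and let c > 0 be a real number. Define C₀ = I_{N_r} and C_i = I_{N_r} + c · H (Σ_{j=1}^{i} F_j F_j*) H* for i = 1, …, m. Then every C_i is invertible and det(C_m) = Π_{i=1}^{m} det(I_{k_i} + c · F_i* H* C_{i-1}⁻¹ H F_i); in particular all determinants appearing are positive reals, so the total achievable rate log₂det(I_{N_r} + c·H(Σ_i F_i F_i*)H*) equals the sum Σ_{i=1}^{m} log₂det(I_{k_i} + c · F_i* H* C_{i-1}⁻¹ H F_i) of the sub-rates of the individual sub-arrays. -/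
open Matrix
open scoped ComplexOrder

/-- Full telescoping decomposition of the total achievable rate (step (c) of eq. (21)):
with `C i = I + c · H (Σ_{j<i} F_j F_j*) H*` (so `C 0 = I`), every `C i` is invertible,
`det (C m) = Π_i det(I + c · F_i* H* (C i)⁻¹ H F_i)`, each factor is a positive real,
and `log₂ det(C m) = Σ_i log₂ det(I + c · F_i* H* (C i)⁻¹ H F_i)`. -/
theorem stmt1 {Nr Nt m : ℕ} (hm : 1 ≤ m) (k : Fin m → ℕ)
    (H : Matrix (Fin Nr) (Fin Nt) ℂ)
    (F : (i : Fin m) → Matrix (Fin Nt) (Fin (k i)) ℂ)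
    (c : ℝ) (hc : 0 < c)
    (C : ℕ → Matrix (Fin Nr) (Fin Nr) ℂ)
    (hC : ∀ i : ℕ,
      C i = 1 + (c : ℂ) •
        (H * (∑ j : Fin m, if (j : ℕ) < i then F j * (F j)ᴴ else 0) * Hᴴ))
    (D : Fin m → ℂ)
    (hD : ∀ i : Fin m,
      D i = (1 + (c : ℂ) • ((F i)ᴴ * Hᴴ * (C (i : ℕ))⁻¹ * H * F i)).det) :
    (∀ i : ℕ, i ≤ m → IsUnit (C i)) ∧
    (C m).det = ∏ i : Fin m, D i ∧
    (∀ i : Fin m, (D i).im = 0 ∧ 0 < (D i).re) ∧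
    ((C m).det).im = 0 ∧ 0 < ((C m).det).re ∧
    Real.logb 2 ((C m).det).re = ∑ i : Fin m, Real.logb 2 (D i).re := by
  have hpd : ∀ i, (C i).PosDef := by
    intro i
    rw [hC]
    refine Matrix.PosDef.one.add_posSemidef ?_
    refine Matrix.PosSemidef.smul ?_ (by exact_mod_cast hc.le)
    refine Matrix.PosSemidef.mul_mul_conjTranspose_same ?_ H
    refine Matrix.posSemidef_sum _ ?_
    intro j _
    split_ifs
    · exact Matrix.posSemidef_self_mul_conjTranspose _
    · exact Matrix.PosSemidef.zero
  have hpos : ∀ i, 0 < (C i).det := fun i => (hpd i).det_pos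
  have hstep : ∀ i : Fin m, (C ((i : ℕ) + 1)).det = (C (i : ℕ)).det * D i := by
    intro i
    have h1 : C ((i : ℕ) + 1) = C (i : ℕ) + ((c : ℂ) • (H * F i)) * ((F i)ᴴ * Hᴴ) := by
      have h2 : (∑ j : Fin m, if (j : ℕ) < (i : ℕ) + 1 then F j * (F j)ᴴ else 0)
          = (∑ j : Fin m, if (j : ℕ) < (i : ℕ) then F j * (F j)ᴴ else 0) + F i * (F i)ᴴ := by
        have h3 : F i * (F i)ᴴ = ∑ j : Fin m, if j = i then F j * (F j)ᴴ else 0 := by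
          simp
        rw [h3, ← Finset.sum_add_distrib]
        refine Finset.sum_congr rfl fun j _ => ?_
        by_cases hj : j = i
        · subst hj
          simp
        · have : (j : ℕ) ≠ i := fun h => hj (Fin.ext h)
          have h4 : (j : ℕ) < (i : ℕ) + 1 ↔ (j : ℕ) < i := by omega
          simp [hj, h4]
      rw [hC, hC, h2, Matrix.mul_add, Matrix.add_mul, smul_add, ← add_assoc, Matrix.smul_mul]
      simp only [Matrix.mul_assoc]
    rw [h1, Matrix.det_add_mul _ _ ((Matrix.isUnit_iff_isUnit_det _).1 (hpd i).isUnit), hD]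
    simp only [Matrix.mul_assoc, Matrix.mul_smul]
  have hDpos : ∀ i, 0 < D i := by
    intro i
    have h := hstep i
    have h0 := hpos (i : ℕ)
    have h1 := hpos ((i : ℕ) + 1)
    rw [h] at h1
    exact (mul_pos_iff_of_pos_left h0).1 h1
  have hprod : ∀ n (hn : n ≤ m), (C n).det = ∏ i : Fin n, D (Fin.castLE hn i) := by
    intro n
    induction n with
    | zero => intro _; simp [hC]
    | succ n ih =>
      intro hn
      rw [Fin.prod_univ_castSucc]
      have := hstep ⟨n, hn⟩
      simp only at this
      rw [this, ih (by omega)]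
      rfl
  have hdet : (C m).det = ∏ i : Fin m, D i := by
    simpa using hprod m le_rfl
  have hre : ∀ i, D i = (((D i).re : ℝ) : ℂ) := fun i =>
    Complex.ext rfl (by simpa using (Complex.lt_def.1 (hDpos i)).2.symm)
  have hD' : ∀ i : Fin m, (D i).im = 0 ∧ 0 < (D i).re := fun i =>
    ⟨by simpa using (Complex.lt_def.1 (hDpos i)).2.symm, by simpa using (Complex.lt_def.1 (hDpos i)).1⟩
  refine ⟨fun i _ => (hpd i).isUnit, hdet, hD', ?_, ?_, ?_⟩
  · simpa using (Complex.lt_def.1 (hpos m)).2.symm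
  · simpa using (Complex.lt_def.1 (hpos m)).1
  · have h5 : (C m).det.re = ∏ i, (D i).re := by
      have h6 : (C m).det = ((∏ i, (D i).re : ℝ) : ℂ) := by
        rw [hdet, Complex.ofReal_prod]
        exact Finset.prod_congr rfl fun i _ => hre i
      rw [h6, Complex.ofReal_re]
    rw [h5, Real.logb_prod]
    intro i _
    exact (hD' i).2.ne'
end
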